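/- Let r ≥ 2 and h ≥ 1 be integers and let κ, δ, n be positive integers with κ + 1 ≤ δ < κ + h and n ≥ κ + r(h+1). Let G be a connected simple graph on n vertices with minimum degree δ and h-extra r-component connectivity κ^h_r(G) = κ. Then ρ(G) ≤ ρ(G*), where G* is the graph obtained from K_κ ∨ (K_{n−κ−(r−1)(h+1)} ∪ (r−2)K_{h+1} ∪ K_h ∪ K_1) by adding δ−κ edges between the vertex of K_1 and δ−κ vertices of K_h. Equality holds if and only if G is isomorphic to G*. -/

import Mathlib

open SimpleGraph

section Core

variable {V : Type*}

lemma adjMatrix_isHermitian [Fintype V] [DecidableEq V]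
    (G : SimpleGraph V) [DecidableRel G.Adj] :
    (G.adjMatrix ℝ).IsHermitian := by
  ext i j
  simp [Matrix.conjTranspose_apply, SimpleGraph.adj_comm]

/-- The spectral radius (largest adjacency eigenvalue) of a finite simple graph. -/
noncomputable def SimpleGraph.spectralRadius [Finite V] (G : SimpleGraph V) : ℝ :=
  letI := Fintype.ofFinite V
  letI := Classical.decEq V
  letI := Classical.decRel G.Adj
  ⨆ i, (adjMatrix_isHermitian G).eigenvalues i

/-- `x` is the Perron vector of a connected graph `G`: a positive unit eigenvector
of the adjacency matrix for the eigenvalue `G.spectralRadius`. -/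
def SimpleGraph.IsPerronVector [Fintype V] [DecidableEq V] (G : SimpleGraph V)
    [DecidableRel G.Adj] (x : V → ℝ) : Prop :=
  (∀ v, 0 < x v) ∧ (∑ v, x v ^ 2 = 1) ∧
    (G.adjMatrix ℝ).mulVec x = G.spectralRadius • x

/-- `S` is a vertex cut witnessing the `h`-extra `r`-component condition: removing `S`
leaves at least `r` connected components, each with at least `h+1` vertices. -/
def GoodVertexCut (G : SimpleGraph V) (r h : ℕ) (S : Finset V) : Prop :=
  r ≤ Nat.card (G.induce ((S : Set V)ᶜ)).ConnectedComponent ∧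
    ∀ c : (G.induce ((S : Set V)ᶜ)).ConnectedComponent, h + 1 ≤ Nat.card c.supp

/-- `G` has `h`-extra `r`-component connectivity `κ`. -/
def HasExtraConnectivity (G : SimpleGraph V) (r h κ : ℕ) : Prop :=
  (∃ S : Finset V, S.card = κ ∧ GoodVertexCut G r h S) ∧
    ∀ S : Finset V, GoodVertexCut G r h S → κ ≤ S.card

/-- `F` is an edge cut witnessing the `h`-extra `r`-component condition: removing `F`
leaves at least `r` connected components, each with at least `h+1` vertices. -/
def GoodEdgeCut (G : SimpleGraph V) (r h : ℕ) (F : Finset (Sym2 V)) : Prop :=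
  (F : Set (Sym2 V)) ⊆ G.edgeSet ∧
    r ≤ Nat.card (G.deleteEdges (F : Set (Sym2 V))).ConnectedComponent ∧
    ∀ c : (G.deleteEdges (F : Set (Sym2 V))).ConnectedComponent, h + 1 ≤ Nat.card c.supp

/-- `G` has `h`-extra `r`-component edge-connectivity `lam`. -/
def HasExtraEdgeConnectivity (G : SimpleGraph V) (r h lam : ℕ) : Prop :=
  (∃ F : Finset (Sym2 V), F.card = lam ∧ GoodEdgeCut G r h F) ∧
    ∀ F : Finset (Sym2 V), GoodEdgeCut G r h F → lam ≤ F.card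

end Core

/-- Vertex type used for the extremal graphs of Theorem 1.2 (cases `δ ≤ κ` and
`κ < δ < κ + h`): the parts are `K_κ`, `K_{n-κ-(r-1)(h+1)}`, the `r-2` copies of
`K_{h+1}`, `K_h`, and `K_1`. -/
abbrev GVert (n r h κ : ℕ) : Type :=
  Fin κ ⊕ (Fin (n - κ - (r - 1) * (h + 1)) ⊕ ((Fin (r - 2) × Fin (h + 1)) ⊕ (Fin h ⊕ Unit)))

/-- The extremal graph `G^{κ,δ}_n` for `κ + 1 ≤ δ < κ + h`: it is obtained from
`K_κ ∨ (K_{n-κ-(r-1)(h+1)} ∪ (r-2)K_{h+1} ∪ K_h ∪ K_1)` by adding `δ - κ` edges between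
the vertex of `K_1` and `δ - κ` vertices of `K_h`. -/
def GStarMid (n r h κ δ : ℕ) : SimpleGraph (GVert n r h κ) :=
  SimpleGraph.fromRel fun a b =>
    match a, b with
    | .inl _, _ => True
    | .inr (.inl _), .inr (.inl _) => True
    | .inr (.inr (.inl p)), .inr (.inr (.inl q)) => p.1 = q.1
    | .inr (.inr (.inr (.inl _))), .inr (.inr (.inr (.inl _))) => True
    | .inr (.inr (.inr (.inl k))), .inr (.inr (.inr (.inr _))) => (k : ℕ) < δ - κ
    | _, _ => False

section Spectral

variable {V : Type*} [Fintype V]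

open scoped Classical in
/-- The total weight of the vertices satisfying `P`. -/
noncomputable def weightOf (x : V → ℝ) (P : V → Prop) : ℝ :=
  ∑ b, if P b then x b else 0

/-- The weighted degree `∑_{b ∼ a} x b` of the vertex `a`. -/
noncomputable def nbrSum (G : SimpleGraph V) (x : V → ℝ) (a : V) : ℝ :=
  weightOf x (G.Adj a)

lemma weightOf_eq_add {x : V → ℝ} {P Q R : V → Prop} (h : ∀ b, R b ↔ P b ∨ Q b)
    (hd : ∀ b, P b → ¬ Q b) : weightOf x R = weightOf x P + weightOf x Q := by
  rw [weightOf, weightOf, weightOf, ← Finset.sum_add_distrib]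
  refine Finset.sum_congr rfl fun b _ => ?_
  have h1 := h b
  have h2 := hd b
  by_cases hP : P b <;> by_cases hQ : Q b <;> simp_all

lemma weightOf_congr {x : V → ℝ} {P Q : V → Prop} (h : ∀ b, P b ↔ Q b) :
    weightOf x P = weightOf x Q := by
  rw [funext fun b => propext (h b)]

lemma weightOf_eq (x : V → ℝ) (a : V) : weightOf x (· = a) = x a := by
  rw [weightOf, Finset.sum_eq_single a] <;> simp +contextual

lemma weightOf_le_add {x : V → ℝ} (hx : ∀ a, 0 ≤ x a) {P Q R : V → Prop}
    (h : ∀ b, P b → Q b ∨ R b) : weightOf x P ≤ weightOf x Q + weightOf x R := by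
  rw [weightOf, weightOf, weightOf, ← Finset.sum_add_distrib]
  refine Finset.sum_le_sum fun b _ => ?_
  have h1 := h b
  have h2 := hx b
  by_cases hP : P b <;> by_cases hQ : Q b <;> by_cases hR : R b <;> simp_all

lemma weightOf_nonneg {x : V → ℝ} (hx : ∀ a, 0 ≤ x a) (P : V → Prop) : 0 ≤ weightOf x P := by
  refine Finset.sum_nonneg fun b _ => ?_
  split_ifs
  exacts [hx b, le_rfl]

lemma weightOf_pos {x : V → ℝ} (hx : ∀ a, 0 < x a) {P : V → Prop} {a : V} (ha : P a) :
    0 < weightOf x P := by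
  refine Finset.sum_pos' (fun b _ => ?_) ⟨a, Finset.mem_univ a, by simpa [ha] using hx a⟩
  split_ifs
  exacts [(hx b).le, le_rfl]

lemma weightOf_mem_finset (x : V → ℝ) (s : Finset V) : weightOf x (· ∈ s) = ∑ b ∈ s, x b := by
  simp [weightOf]

/-- The quadratic form of the adjacency matrix of `G`. -/
noncomputable def adjForm (G : SimpleGraph V) (x : V → ℝ) : ℝ :=
  ∑ a, x a * nbrSum G x a

lemma spectralRadius_eq_iSup [DecidableEq V] (G : SimpleGraph V) [DecidableRel G.Adj] :
    G.spectralRadius = ⨆ i, (adjMatrix_isHermitian G).eigenvalues i := by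
  unfold SimpleGraph.spectralRadius
  congr!

lemma adjMatrix_mulVec_eq_nbrSum (G : SimpleGraph V) [DecidableRel G.Adj]
    (x : V → ℝ) : (G.adjMatrix ℝ).mulVec x = nbrSum G x := by
  ext a
  simp only [Matrix.mulVec, dotProduct, SimpleGraph.adjMatrix_apply, nbrSum, weightOf, ite_mul, one_mul,
    zero_mul]
  congr!

lemma posSemidef_spectralRadius_sub [DecidableEq V] (G : SimpleGraph V) [DecidableRel G.Adj] :
    (G.spectralRadius • (1 : Matrix V V ℝ) - G.adjMatrix ℝ).PosSemidef := by
  have hA := adjMatrix_isHermitian G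
  have hd : (Matrix.diagonal fun i => G.spectralRadius - hA.eigenvalues i).PosSemidef := by
    refine Matrix.PosSemidef.diagonal fun i => ?_
    rw [spectralRadius_eq_iSup]
    exact sub_nonneg.2 (le_ciSup (Set.finite_range _).bddAbove i)
  have h := hd.mul_mul_conjTranspose_same (hA.eigenvectorUnitary : Matrix V V ℝ)
  convert h using 1
  have hs := hA.spectral_theorem
  have hu : (hA.eigenvectorUnitary : Matrix V V ℝ) *
      (hA.eigenvectorUnitary : Matrix V V ℝ).conjTranspose = 1 :=
    Matrix.mem_unitaryGroup_iff.1 hA.eigenvectorUnitary.2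
  have hdiag : (Matrix.diagonal fun i => G.spectralRadius - hA.eigenvalues i) =
      G.spectralRadius • (1 : Matrix V V ℝ) - Matrix.diagonal hA.eigenvalues := by
    ext i j
    by_cases hij : i = j <;> simp [hij, Matrix.diagonal]
  rw [hdiag, mul_sub, sub_mul, mul_smul_comm, mul_one, smul_mul_assoc, hu]
  congr 1

lemma adjForm_le (G : SimpleGraph V) (x : V → ℝ) :
    adjForm G x ≤ G.spectralRadius * ∑ a, x a ^ 2 := by
  classical
  have h := (posSemidef_spectralRadius_sub G).dotProduct_mulVec_nonneg x
  rw [Matrix.sub_mulVec, adjMatrix_mulVec_eq_nbrSum, Matrix.smul_mulVec, Matrix.one_mulVec,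
    dotProduct_sub, dotProduct_smul] at h
  simp only [dotProduct, star_trivial, smul_eq_mul] at h
  have e : ∑ a, x a ^ 2 = ∑ a, x a * x a := Finset.sum_congr rfl fun a _ => sq (x a)
  rw [e]
  unfold adjForm
  linarith

lemma nbrSum_eq_of_adjForm_eq (G : SimpleGraph V) (x : V → ℝ)
    (hx : adjForm G x = G.spectralRadius * ∑ a, x a ^ 2) (a : V) :
    nbrSum G x a = G.spectralRadius * x a := by
  classical
  have h := (posSemidef_spectralRadius_sub G).dotProduct_mulVec_zero_iff x
  rw [Matrix.sub_mulVec, adjMatrix_mulVec_eq_nbrSum, Matrix.smul_mulVec, Matrix.one_mulVec,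
    dotProduct_sub, dotProduct_smul] at h
  simp only [dotProduct, star_trivial, smul_eq_mul] at h
  have e : ∑ a, x a ^ 2 = ∑ a, x a * x a := Finset.sum_congr rfl fun a _ => sq (x a)
  rw [e] at hx
  have h' := congrFun (h.1 (by unfold adjForm at hx; linarith)) a
  simp only [Pi.sub_apply, Pi.smul_apply, smul_eq_mul, Pi.zero_apply] at h'
  linarith

lemma adjForm_eq_of_nbrSum_eq {G : SimpleGraph V} {x : V → ℝ} {c : ℝ}
    (hx : ∀ a, nbrSum G x a = c * x a) : adjForm G x = c * ∑ a, x a ^ 2 := by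
  rw [adjForm, Finset.mul_sum]
  exact Finset.sum_congr rfl fun a _ => by rw [hx]; ring

lemma nbrSum_mono {G H : SimpleGraph V} (hGH : G ≤ H) {x : V → ℝ} (hx : ∀ a, 0 ≤ x a) (a : V) :
    nbrSum G x a ≤ nbrSum H x a := by
  refine Finset.sum_le_sum fun b _ => ?_
  have := hx b
  by_cases h : G.Adj a b
  · simp [h, hGH h]
  · simp only [h, if_false]
    split_ifs <;> linarith

lemma adjForm_mono {G H : SimpleGraph V} (hGH : G ≤ H) {x : V → ℝ} (hx : ∀ a, 0 ≤ x a) :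
    adjForm G x ≤ adjForm H x :=
  Finset.sum_le_sum fun a _ => mul_le_mul_of_nonneg_left (nbrSum_mono hGH hx a) (hx a)

lemma adjForm_le_adjForm_abs (G : SimpleGraph V) (x : V → ℝ) :
    adjForm G x ≤ adjForm G fun a => |x a| := by
  refine Finset.sum_le_sum fun a _ => ?_
  simp only [nbrSum, weightOf, Finset.mul_sum]
  refine Finset.sum_le_sum fun b _ => ?_
  split_ifs
  · exact (le_abs_self _).trans (abs_mul _ _).le
  · simp

lemma exists_nonneg_eigenvector [Nonempty V] (G : SimpleGraph V) :
    ∃ x : V → ℝ, (∀ a, 0 ≤ x a) ∧ x ≠ 0 ∧ ∀ a, nbrSum G x a = G.spectralRadius * x a := by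
  classical
  have hA := adjMatrix_isHermitian G
  obtain ⟨i, hi⟩ := exists_eq_ciSup_of_finite (f := hA.eigenvalues)
  rw [← spectralRadius_eq_iSup] at hi
  set y : V → ℝ := ⇑(hA.eigenvectorBasis i) with hy
  have hmul := hA.mulVec_eigenvectorBasis i
  rw [adjMatrix_mulVec_eq_nbrSum, hi] at hmul
  have hy0 : y ≠ 0 := by
    intro h0
    refine hA.eigenvectorBasis.toBasis.ne_zero i ?_
    ext a
    simpa using congrFun h0 a
  have hyf : adjForm G y = G.spectralRadius * ∑ a, y a ^ 2 :=
    adjForm_eq_of_nbrSum_eq fun a => by simpa using congrFun hmul a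
  have hsq : ∑ a, |y a| ^ 2 = ∑ a, y a ^ 2 := Finset.sum_congr rfl fun a _ => sq_abs _
  refine ⟨fun a => |y a|, fun a => abs_nonneg _, ?_, ?_⟩
  · intro h0
    exact hy0 (funext fun a => by simpa using congrFun h0 a)
  · refine nbrSum_eq_of_adjForm_eq G _ (le_antisymm (adjForm_le _ _) ?_)
    rw [hsq, ← hyf]
    exact adjForm_le_adjForm_abs G y

lemma pos_of_connected {G : SimpleGraph V} (hG : G.Connected) {x : V → ℝ} (hx : ∀ a, 0 ≤ x a)
    (hx0 : x ≠ 0) {c : ℝ} (he : ∀ a, nbrSum G x a = c * x a) (a : V) : 0 < x a := by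
  by_contra ha
  have ha0 : x a = 0 := le_antisymm (not_lt.1 ha) (hx a)
  have step : ∀ u w, G.Adj u w → x u = 0 → x w = 0 := by
    intro u w huw hu
    have h := he u
    rw [hu, mul_zero, nbrSum, weightOf, Finset.sum_eq_zero_iff_of_nonneg] at h
    · simpa [huw] using h w (Finset.mem_univ w)
    · intro b _
      split_ifs
      exacts [hx b, le_rfl]
  have walk : ∀ u w, G.Walk u w → x u = 0 → x w = 0 := by
    intro u w p
    induction p with
    | nil => exact id
    | cons h _ ih => exact fun hu => ih (step _ _ h hu)
  exact hx0 (funext fun w => walk a w (hG.preconnected a w).some ha0)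

lemma exists_pos_eigenvector {G : SimpleGraph V} (hG : G.Connected) :
    ∃ x : V → ℝ, (∀ a, 0 < x a) ∧ ∀ a, nbrSum G x a = G.spectralRadius * x a := by
  have := hG.nonempty
  obtain ⟨x, hx, hx0, he⟩ := exists_nonneg_eigenvector G
  exact ⟨x, pos_of_connected hG hx hx0 he, he⟩

lemma spectralRadius_nonneg_of_pos {G : SimpleGraph V} {x : V → ℝ} (hx : ∀ a, 0 < x a)
    (he : ∀ a, nbrSum G x a = G.spectralRadius * x a) (a : V) : 0 ≤ G.spectralRadius := by
  have h1 : 0 ≤ nbrSum G x a := weightOf_nonneg (fun b => (hx b).le) _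
  rw [he] at h1
  exact nonneg_of_mul_nonneg_left h1 (hx a)

lemma sum_sq_pos {x : V → ℝ} (hx : ∀ a, 0 < x a) (a : V) : 0 < ∑ b, x b ^ 2 :=
  Finset.sum_pos (fun b _ => pow_pos (hx b) 2) ⟨a, Finset.mem_univ a⟩

lemma spectralRadius_lt_of_adjForm_le {G H : SimpleGraph V} {x : V → ℝ} (hx : ∀ a, 0 < x a)
    (he : ∀ a, nbrSum G x a = G.spectralRadius * x a) (hq : adjForm G x ≤ adjForm H x)
    {a : V} (ha : nbrSum G x a ≠ nbrSum H x a) : G.spectralRadius < H.spectralRadius := by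
  by_contra hlt
  have hs := sum_sq_pos hx a
  have h1 := adjForm_eq_of_nbrSum_eq he
  have h2 := adjForm_le H x
  have h3 := mul_le_mul_of_nonneg_right (not_lt.1 hlt) hs.le
  have h4 := nbrSum_eq_of_adjForm_eq H x (by linarith) a
  have h5 : H.spectralRadius = G.spectralRadius :=
    mul_right_cancel₀ hs.ne' (by linarith)
  exact ha (by rw [he, h4, h5])

lemma spectralRadius_lt_of_adjForm_lt {G H : SimpleGraph V} {x : V → ℝ}
    (he : ∀ a, nbrSum G x a = G.spectralRadius * x a) (hq : adjForm G x < adjForm H x) :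
    G.spectralRadius < H.spectralRadius := by
  by_contra hlt
  have h3 := mul_le_mul_of_nonneg_right (not_lt.1 hlt)
    (Finset.sum_nonneg fun b (_ : b ∈ Finset.univ) => sq_nonneg (x b))
  linarith [adjForm_eq_of_nbrSum_eq he, adjForm_le H x]

lemma spectralRadius_le_of_iso {W : Type*} [Fintype W] {G : SimpleGraph V} {H : SimpleGraph W}
    (e : G ≃g H) : G.spectralRadius ≤ H.spectralRadius := by
  cases isEmpty_or_nonempty V
  · have : IsEmpty W := e.symm.toEquiv.isEmpty
    classical
    rw [spectralRadius_eq_iSup, spectralRadius_eq_iSup, Real.iSup_of_isEmpty, Real.iSup_of_isEmpty]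
  obtain ⟨x, -, hx0, he⟩ := exists_nonneg_eigenvector G
  have hn : ∀ a, nbrSum H (fun w => x (e.symm w)) (e a) = nbrSum G x a := by
    intro a
    refine (Fintype.sum_equiv e.toEquiv _ _ fun b => ?_).symm
    have hab := e.map_adj_iff (v := a) (w := b)
    by_cases h : G.Adj a b <;> simp_all
  have hf : adjForm H (fun w => x (e.symm w)) = adjForm G x := by
    refine (Fintype.sum_equiv e.toEquiv _ _ fun a => ?_).symm
    have := hn a
    simp_all
  have hs : ∑ w, x (e.symm w) ^ 2 = ∑ a, x a ^ 2 :=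
    (Fintype.sum_equiv e.toEquiv _ _ fun a => by simp).symm
  have h1 := adjForm_le H fun w => x (e.symm w)
  rw [hf, adjForm_eq_of_nbrSum_eq he, hs] at h1
  refine le_of_mul_le_mul_right h1 ?_
  obtain ⟨a, ha⟩ := Function.ne_iff.1 hx0
  exact Finset.sum_pos' (fun b _ => sq_nonneg _) ⟨a, Finset.mem_univ a, by
    have : x a ≠ 0 := ha
    positivity⟩

lemma spectralRadius_eq_of_iso {W : Type*} [Fintype W] {G : SimpleGraph V} {H : SimpleGraph W}
    (e : G ≃g H) : G.spectralRadius = H.spectralRadius :=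
  (spectralRadius_le_of_iso e).antisymm (spectralRadius_le_of_iso e.symm)

/-- If two graphs differ only in edges joining `Z` to its complement, the change of the quadratic
form is determined by the weighted degrees of the vertices of `Z`. -/
lemma adjForm_sub_adjForm {G H : SimpleGraph V} {Z : Finset V} (x : V → ℝ)
    (hin : ∀ a ∈ Z, ∀ b ∈ Z, (G.Adj a b ↔ H.Adj a b))
    (hout : ∀ a ∉ Z, ∀ b ∉ Z, (G.Adj a b ↔ H.Adj a b)) :
    adjForm H x - adjForm G x = 2 * ∑ z ∈ Z, x z * (nbrSum H x z - nbrSum G x z) := by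
  classical
  let d : V → V → ℝ := fun a b =>
    x a * ((if H.Adj a b then x b else 0) - if G.Adj a b then x b else 0)
  have hd : ∀ a, x a * (nbrSum H x a - nbrSum G x a) = ∑ b, d a b := by
    intro a
    rw [nbrSum, nbrSum, weightOf, weightOf, ← Finset.sum_sub_distrib, Finset.mul_sum]
  have hsymm : ∀ a b, d a b = d b a := by
    intro a b
    simp only [d, H.adj_comm a b, G.adj_comm a b]
    split_ifs <;> ring
  have hz : ∀ a b, (G.Adj a b ↔ H.Adj a b) → d a b = 0 := by
    intro a b h
    simp [d, h]
  have h1 : adjForm H x - adjForm G x = ∑ a, ∑ b, d a b := by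
    rw [adjForm, adjForm, ← Finset.sum_sub_distrib]
    exact Finset.sum_congr rfl fun a _ => by rw [← hd]; ring
  have h2 : ∑ a ∈ Zᶜ, ∑ b, d a b = ∑ a ∈ Z, ∑ b, d a b := by
    have e1 : ∑ a ∈ Zᶜ, ∑ b, d a b = ∑ a ∈ Zᶜ, ∑ b ∈ Z, d a b := by
      refine Finset.sum_congr rfl fun a ha => ?_
      rw [← Finset.sum_add_sum_compl Z, Finset.sum_eq_zero (s := Zᶜ), add_zero]
      exact fun b hb => hz a b (hout a (Finset.mem_compl.1 ha) b (Finset.mem_compl.1 hb))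
    have e2 : ∑ a ∈ Z, ∑ b, d a b = ∑ a ∈ Z, ∑ b ∈ Zᶜ, d a b := by
      refine Finset.sum_congr rfl fun a ha => ?_
      rw [← Finset.sum_add_sum_compl Z, Finset.sum_eq_zero (s := Z), zero_add]
      exact fun b hb => hz a b (hin a ha b hb)
    rw [e1, e2, Finset.sum_comm]
    exact Finset.sum_congr rfl fun a _ => Finset.sum_congr rfl fun b _ => hsymm _ _
  rw [h1, ← Finset.sum_add_sum_compl Z, h2, Finset.sum_congr rfl fun a _ => hd a]
  ring

end Spectral

section CutGraph

variable {V : Type*} {r : ℕ}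

/-- Vertices with `f a = none` form a cut, and the other vertices are distributed over `r` parts.
Apart from `v`, whose set of neighbours is `N`, two vertices are adjacent if one of them is in the
cut or both are in the same part. -/
def cutGraph (f : V → Option (Fin r)) (v : V) (N : Finset V) : SimpleGraph V where
  Adj a b := a ≠ b ∧ ((a ≠ v ∧ b ≠ v ∧ (f a = none ∨ f b = none ∨ f a = f b)) ∨
    (a = v ∧ b ∈ N) ∨ (b = v ∧ a ∈ N))
  symm.symm := by grind
  loopless.irrefl := by grind

lemma cutGraph_adj {f : V → Option (Fin r)} {v : V} {N : Finset V} {a b : V} :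
    (cutGraph f v N).Adj a b ↔
      a ≠ b ∧ ((a ≠ v ∧ b ≠ v ∧ (f a = none ∨ f b = none ∨ f a = f b)) ∨
        (a = v ∧ b ∈ N) ∨ (b = v ∧ a ∈ N)) := Iff.rfl

variable [Fintype V]

/-- The cut has `κ` vertices, every part has at least `h + 1` vertices, and the vertex `v`
belongs to a part and has `δ` neighbours, all in the cut or in its own part. -/
structure IsCutData (h κ δ : ℕ) (f : V → Option (Fin r)) (v : V) (N : Finset V) : Prop where
  ne_none : f v ≠ none
  mem : ∀ b ∈ N, b ≠ v ∧ (f b = none ∨ f b = f v)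
  card_nbrs : N.card = δ
  card_cut : (Finset.univ.filter (f · = none)).card = κ
  card_part : ∀ i, h + 1 ≤ (Finset.univ.filter (f · = some i)).card

variable {h κ δ : ℕ}

lemma card_filter_comp_swap [DecidableEq V] (f : V → Option (Fin r)) (u w : V) (c : Option (Fin r)) :
    (Finset.univ.filter fun a => f (Equiv.swap u w a) = c).card =
      (Finset.univ.filter (f · = c)).card := by
  refine Finset.card_equiv (Equiv.swap u w) fun a => ?_
  simp

lemma card_filter_none_or_some [DecidableEq V] (f : V → Option (Fin r)) (i : Fin r) :
    (Finset.univ.filter fun b => f b = none ∨ f b = some i).card =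
      (Finset.univ.filter (f · = none)).card + (Finset.univ.filter (f · = some i)).card := by
  rw [Finset.filter_or, Finset.card_union_of_disjoint]
  exact Finset.disjoint_filter.2 fun b _ h1 h2 => by simp [h1] at h2

lemma exists_part_ne (hr : 2 ≤ r) {f : V → Option (Fin r)}
    (hC : ∀ i, h + 1 ≤ (Finset.univ.filter (f · = some i)).card) (i : Fin r) :
    ∃ b, f b ≠ none ∧ f b ≠ some i := by
  have : Nontrivial (Fin r) := Fin.nontrivial_iff_two_le.2 hr
  obtain ⟨j, hj⟩ := exists_ne i
  obtain ⟨b, hb⟩ := Finset.card_pos.1 ((Nat.succ_pos h).trans_le (hC j))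
  rw [Finset.mem_filter] at hb
  exact ⟨b, by simp [hb.2], by simpa [hb.2] using hj⟩

lemma exists_mem_ne_none {f : V → Option (Fin r)} {N : Finset V}
    (hS : (Finset.univ.filter (f · = none)).card < N.card) : ∃ u ∈ N, f u ≠ none := by
  by_contra! hcon
  exact absurd (Finset.card_le_card fun u hu => by simpa using hcon u hu) (not_le.2 hS)

variable [DecidableEq V]

/-- If the vertex of degree `δ` lies in the cut, there is a better graph in which it does not. -/
lemma exists_isCutData_of_eq_none {x : V → ℝ} (hx : ∀ a, 0 < x a) (hr : 2 ≤ r) (hκδ : κ + 1 ≤ δ)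
    (hδ : δ < κ + h) (hV : κ + r * (h + 1) ≤ Fintype.card V) {f : V → Option (Fin r)} {v : V}
    {N : Finset V} (hv : f v = none) (hvN : v ∉ N) (hN : N.card = δ)
    (hS : (Finset.univ.filter (f · = none)).card = κ)
    (hC : ∀ i, h + 1 ≤ (Finset.univ.filter (f · = some i)).card) :
    ∃ (f' : V → Option (Fin r)) (v' : V) (N' : Finset V), IsCutData h κ δ f' v' N' ∧
      adjForm (cutGraph f v N) x ≤ adjForm (cutGraph f' v' N') x ∧
      ∃ a, nbrSum (cutGraph f v N) x a < nbrSum (cutGraph f' v' N') x a := by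
  obtain ⟨u, huN, hu⟩ := exists_mem_ne_none (f := f) (N := N) (by omega)
  obtain ⟨i, hi⟩ := Option.ne_none_iff_exists'.1 hu
  have huv : u ≠ v := fun h => hvN (h ▸ huN)
  have hx' : ∀ a, 0 ≤ x a := fun a => (hx a).le
  have hU := card_filter_none_or_some f i
  have hCi := hC i
  set U := Finset.univ.filter fun b => f b = none ∨ f b = some i with hUdef
  have hmU : ∀ b, b ∈ U ↔ f b = none ∨ f b = some i := by simp [hUdef]
  rcases le_or_gt (x v) (x u) with hxuv | hxuv
  · obtain ⟨N', hN1, hN2, hN3⟩ := Finset.exists_subsuperset_card_eq (n := δ)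
      (s := N ∩ U) (t := U.erase v) (by grind)
      ((Finset.card_le_card Finset.inter_subset_left).trans hN.le)
      (by rw [Finset.card_erase_of_mem (by grind)]; omega)
    set f' : V → Option (Fin r) := fun a => f (Equiv.swap u v a) with hf'
    have hf1 : f' u = none := by simp [hf', hv]
    have hf2 : f' v = some i := by simp [hf', hi]
    have hf3 : ∀ a, a ≠ u → a ≠ v → f' a = f a := fun a h1 h2 => by
      simp [hf', Equiv.swap_apply_of_ne_of_ne h1 h2]
    have hdata : IsCutData h κ δ f' v N' := by
      refine ⟨by simp [hf2], ?_, hN3, ?_, ?_⟩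
      · intro b hb
        have := hN2 hb
        by_cases hbu : b = u <;> grind
      · rw [card_filter_comp_swap, hS]
      · exact fun j => by rw [card_filter_comp_swap]; exact hC j
    have hnu : nbrSum (cutGraph f' v N') x u = nbrSum (cutGraph f v N) x u +
        weightOf x (fun b => f b ≠ none ∧ f b ≠ some i) := by
      refine weightOf_eq_add (fun b => ?_) (fun b => ?_)
      · simp only [cutGraph_adj]
        have := hf3 b
        grind
      · simp only [cutGraph_adj]
        grind
    have hnv : nbrSum (cutGraph f v N) x v ≤ nbrSum (cutGraph f' v N') x v +
        weightOf x (fun b => f b ≠ none ∧ f b ≠ some i) := by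
      refine weightOf_le_add hx' fun b => ?_
      simp only [cutGraph_adj]
      grind
    obtain ⟨c, hc⟩ := exists_part_ne hr hC i
    have hO : 0 < weightOf x (fun b => f b ≠ none ∧ f b ≠ some i) := weightOf_pos hx hc
    have hdiff := adjForm_sub_adjForm (G := cutGraph f v N) (H := cutGraph f' v N') (Z := {u, v}) x
      (by simp only [cutGraph_adj]; grind) (by simp only [cutGraph_adj]; grind)
    rw [Finset.sum_pair huv] at hdiff
    refine ⟨f', v, N', hdata, ?_, u, by linarith⟩
    have := hx u
    have := hx v
    nlinarith
  · obtain ⟨N', hN1, hN2, hN3⟩ := Finset.exists_subsuperset_card_eq (n := δ)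
      (s := insert v ((N ∩ U).erase u)) (t := U.erase u) (by grind)
      (by
        refine (Finset.card_insert_le _ _).trans ?_
        rw [Finset.card_erase_of_mem (by grind)]
        have := Finset.card_le_card (Finset.inter_subset_left : N ∩ U ⊆ N)
        omega)
      (by rw [Finset.card_erase_of_mem (by grind)]; omega)
    have hdata : IsCutData h κ δ f u N' := ⟨hu, by grind, hN3, hS, hC⟩
    have hnv : nbrSum (cutGraph f u N') x v = nbrSum (cutGraph f v N) x v +
        weightOf x (fun b => b ≠ v ∧ b ∉ N) := by
      refine weightOf_eq_add (fun b => ?_) (fun b => ?_)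
      · simp only [cutGraph_adj]
        grind
      · simp only [cutGraph_adj]
        grind
    have hnu : nbrSum (cutGraph f v N) x u ≤ nbrSum (cutGraph f u N') x u +
        weightOf x (fun b => b ≠ v ∧ b ∉ N) := by
      refine weightOf_le_add hx' fun b => ?_
      simp only [cutGraph_adj]
      grind
    obtain ⟨c, hc⟩ : ∃ c, c ∉ insert v N := by
      by_contra! hcon
      have h1 := Finset.card_le_card (fun c _ => hcon c : Finset.univ ⊆ insert v N)
      rw [Finset.card_univ, Finset.card_insert_of_notMem hvN] at h1
      nlinarith
    have hO : 0 < weightOf x (fun b => b ≠ v ∧ b ∉ N) := weightOf_pos (a := c) hx (by grind)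
    have hdiff := adjForm_sub_adjForm (G := cutGraph f v N) (H := cutGraph f u N') (Z := {u, v}) x
      (by simp only [cutGraph_adj]; grind) (by simp only [cutGraph_adj]; grind)
    rw [Finset.sum_pair huv] at hdiff
    refine ⟨f, u, N', hdata, ?_, v, by linarith⟩
    have := hx u
    have := hx v
    nlinarith

lemma IsCutData.connected {f : V → Option (Fin r)} {v : V} {N : Finset V}
    (hD : IsCutData h κ δ f v N) (hκ : 1 ≤ κ) (hδ : 1 ≤ δ) : (cutGraph f v N).Connected := by
  obtain ⟨s, hs⟩ := Finset.card_pos.1 (hκ.trans_eq hD.card_cut.symm)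
  obtain ⟨b, hb⟩ := Finset.card_pos.1 (hδ.trans_eq hD.card_nbrs.symm)
  have hs' : f s = none := by simpa using hs
  have hbv := (hD.mem b hb).1
  have hv := hD.ne_none
  have key : ∀ a, a ≠ v → (cutGraph f v N).Reachable s a := by
    intro a ha
    by_cases has : s = a
    · exact has ▸ SimpleGraph.Reachable.refl _
    · refine SimpleGraph.Adj.reachable ?_
      rw [cutGraph_adj]
      grind
  have all : ∀ a, (cutGraph f v N).Reachable s a := by
    intro a
    by_cases ha : a = v
    · refine (key b hbv).trans (SimpleGraph.Adj.reachable ?_)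
      rw [cutGraph_adj]
      grind
    · exact key a ha
  exact (SimpleGraph.connected_iff _).2 ⟨fun a c => (all a).symm.trans (all c), ⟨s⟩⟩

/-- The data have the largest spectral radius among all cut data of the same size. -/
def IsMaxCutData (h κ δ : ℕ) (f : V → Option (Fin r)) (v : V) (N : Finset V) : Prop :=
  IsCutData h κ δ f v N ∧ ∀ (f' : V → Option (Fin r)) (v' : V) (N' : Finset V),
    IsCutData h κ δ f' v' N' →
      (cutGraph f' v' N').spectralRadius ≤ (cutGraph f v N).spectralRadius

section Maximal

variable {f : V → Option (Fin r)} {v : V} {N : Finset V} {x : V → ℝ}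

lemma IsMaxCutData.mem_of_eq_none (hM : IsMaxCutData h κ δ f v N) (hx : ∀ a, 0 < x a)
    (he : ∀ a, nbrSum (cutGraph f v N) x a = (cutGraph f v N).spectralRadius * x a)
    (hr : 2 ≤ r) (hκδ : κ + 1 ≤ δ) (w : V) (hw : f w = none) : w ∈ N := by
  by_contra hwN
  obtain ⟨hD, hmax⟩ := hM
  have hv := hD.ne_none
  have hmem := hD.mem
  obtain ⟨b, hbN, hb⟩ := exists_mem_ne_none (f := f) (N := N)
    (by rw [hD.card_cut, hD.card_nbrs]; omega)
  obtain ⟨i, hi⟩ := Option.ne_none_iff_exists'.1 hb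
  have hvi : f v = some i := by grind
  have hwb : w ≠ b := fun h => hwN (h ▸ hbN)
  have hwv : w ≠ v := fun h => hv (h ▸ hw)
  have hbv := (hmem b hbN).1
  rcases le_or_gt (x b) (x w) with hxwb | hxwb
  · have hdata : IsCutData h κ δ f v (insert w (N.erase b)) := by
      refine ⟨hv, by grind, ?_, hD.card_cut, hD.card_part⟩
      rw [Finset.card_insert_of_notMem (by grind), Finset.card_erase_of_mem hbN, hD.card_nbrs]
      omega
    have hnw : nbrSum (cutGraph f v (insert w (N.erase b))) x w =
        nbrSum (cutGraph f v N) x w + weightOf x (· = v) := by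
      refine weightOf_eq_add (fun c => ?_) (fun c => ?_)
      · simp only [cutGraph_adj]
        grind
      · simp only [cutGraph_adj]
        grind
    have hnv : nbrSum (cutGraph f v (insert w (N.erase b))) x v + x b =
        nbrSum (cutGraph f v N) x v + x w := by
      rw [← weightOf_eq x b, ← weightOf_eq x w]
      rw [nbrSum, nbrSum, ← weightOf_eq_add (R := fun c => c ∈ insert w N),
        ← weightOf_eq_add (R := fun c => c ∈ insert w N)]
      all_goals simp only [cutGraph_adj]; grind
    have hdiff := adjForm_sub_adjForm (G := cutGraph f v N)
      (H := cutGraph f v (insert w (N.erase b))) (Z := {v}) x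
      (by simp) (by simp only [cutGraph_adj]; grind)
    rw [Finset.sum_singleton] at hdiff
    rw [weightOf_eq] at hnw
    have hxv := hx v
    refine absurd (hmax _ _ _ hdata)
      (not_le.2 (spectralRadius_lt_of_adjForm_le hx he ?_ (a := w) (by linarith)))
    nlinarith
  · set f' : V → Option (Fin r) := fun a => f (Equiv.swap w b a) with hf'
    have hf1 : f' b = none := by simp [hf', hw]
    have hf2 : f' w = some i := by simp [hf', hi]
    have hf3 : ∀ a, a ≠ w → a ≠ b → f' a = f a := fun a h1 h2 => by
      simp [hf', Equiv.swap_apply_of_ne_of_ne h1 h2]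
    have hfv : f' v = some i := by rw [hf3 v hwv.symm hbv.symm, hvi]
    have hdata : IsCutData h κ δ f' v N := by
      refine ⟨by simp [hfv], ?_, hD.card_nbrs, ?_, ?_⟩
      · intro c hc
        have := hmem c hc
        have := hf3 c
        grind
      · rw [card_filter_comp_swap, hD.card_cut]
      · exact fun j => by rw [card_filter_comp_swap]; exact hD.card_part j
    have hnb : nbrSum (cutGraph f' v N) x b = nbrSum (cutGraph f v N) x b +
        weightOf x (fun b => f b ≠ none ∧ f b ≠ some i) := by
      refine weightOf_eq_add (fun c => ?_) (fun c => ?_)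
      · simp only [cutGraph_adj]
        have := hf3 c
        grind
      · simp only [cutGraph_adj]
        grind
    have hnw : nbrSum (cutGraph f v N) x w = nbrSum (cutGraph f' v N) x w +
        weightOf x (fun b => f b ≠ none ∧ f b ≠ some i) := by
      refine weightOf_eq_add (fun c => ?_) (fun c => ?_)
      · simp only [cutGraph_adj]
        have := hf3 c
        grind
      · simp only [cutGraph_adj]
        have := hf3 c
        grind
    obtain ⟨c, hc⟩ := exists_part_ne hr hD.card_part i
    have hO : 0 < weightOf x (fun b => f b ≠ none ∧ f b ≠ some i) := weightOf_pos hx hc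
    have hdiff := adjForm_sub_adjForm (G := cutGraph f v N) (H := cutGraph f' v N) (Z := {w, b}) x
      (by simp only [cutGraph_adj]; grind) (by simp only [cutGraph_adj]; grind)
    rw [Finset.sum_pair hwb, hnb, hnw] at hdiff
    refine absurd (hmax _ _ _ hdata) (not_le.2 (spectralRadius_lt_of_adjForm_lt he ?_))
    have := mul_pos (sub_pos.2 hxwb) hO
    linarith

/-- The total weight of a part, not counting the exceptional vertex `v`. -/
noncomputable def partWeight (f : V → Option (Fin r)) (v : V) (x : V → ℝ) (i : Fin r) : ℝ :=
  weightOf x fun b => b ≠ v ∧ f b = some i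

lemma IsMaxCutData.card_filter_ne_none_add (hM : IsMaxCutData h κ δ f v N) (hx : ∀ a, 0 < x a)
    (he : ∀ a, nbrSum (cutGraph f v N) x a = (cutGraph f v N).spectralRadius * x a)
    (hr : 2 ≤ r) (hκδ : κ + 1 ≤ δ) : (N.filter (f · ≠ none)).card + κ = δ := by
  have h1 : N.filter (f · = none) = Finset.univ.filter (f · = none) := by
    ext a
    have := hM.mem_of_eq_none hx he hr hκδ a
    simp
    grind
  have h2 := Finset.card_filter_add_card_filter_not (s := N) (f · = none)
  rw [h1, hM.1.card_cut, hM.1.card_nbrs] at h2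
  simp only [ne_eq]
  omega

lemma IsMaxCutData.partWeight_lt (hM : IsMaxCutData h κ δ f v N) (hx : ∀ a, 0 < x a)
    (he : ∀ a, nbrSum (cutGraph f v N) x a = (cutGraph f v N).spectralRadius * x a)
    (hr : 2 ≤ r) (hκδ : κ + 1 ≤ δ) (hδ : δ < κ + h) {i j : Fin r} (hij : i ≠ j)
    (hi : h + 2 ≤ (Finset.univ.filter (f · = some i)).card) :
    partWeight f v x j < partWeight f v x i := by
  have hT := hM.card_filter_ne_none_add hx he hr hκδ
  obtain ⟨hD, hmax⟩ := hM
  have hv := hD.ne_none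
  have hmem := hD.mem
  obtain ⟨w, hwi, hw⟩ : ∃ w, f w = some i ∧ w ∉ insert v (N.filter (f · ≠ none)) := by
    by_contra! hcon
    have h1 := Finset.card_le_card (s := Finset.univ.filter (f · = some i))
      (t := insert v (N.filter (f · ≠ none))) (fun w hw => hcon w (by simpa using hw))
    have h2 := Finset.card_insert_le v (N.filter (f · ≠ none))
    omega
  have hwv : w ≠ v := by grind
  have hwN : w ∉ N := by grind
  set f' : V → Option (Fin r) := Function.update f w (some j) with hf'
  have hf1 : f' w = some j := by simp [hf']
  have hf2 : ∀ a, a ≠ w → f' a = f a := fun a ha => by simp [hf', ha]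
  have hdata : IsCutData h κ δ f' v N := by
    refine ⟨by rw [hf2 v hwv.symm]; exact hv, ?_, hD.card_nbrs, ?_, ?_⟩
    · intro c hc
      rw [hf2 v hwv.symm, hf2 c (by grind)]
      exact hmem c hc
    · rw [← hD.card_cut]
      congr 1
      ext a
      by_cases haw : a = w <;> simp_all
    · intro k
      have hk : (Finset.univ.filter (f · = some k)).erase w ⊆
          Finset.univ.filter (f' · = some k) := by
        intro a ha
        have := hf2 a
        simp at ha ⊢
        grind
      have h1 := Finset.card_le_card hk
      by_cases hki : k = i
      · subst hki
        rw [Finset.card_erase_of_mem (by simpa using hwi)] at h1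
        omega
      · rw [Finset.erase_eq_of_notMem (by simp; grind)] at h1
        exact (hD.card_part k).trans h1
  have hnw : nbrSum (cutGraph f v N) x w + (x w + partWeight f v x j) =
      nbrSum (cutGraph f' v N) x w + partWeight f v x i := by
    have h1 : weightOf x (fun c => c ≠ v ∧ (f c = none ∨ f c = some i ∨ f c = some j)) =
        weightOf x (fun c => (cutGraph f v N).Adj w c) +
          weightOf x (fun c => c = w ∨ (c ≠ v ∧ f c = some j)) :=
      weightOf_eq_add (by simp only [cutGraph_adj]; grind) (by simp only [cutGraph_adj]; grind)
    have h2 : weightOf x (fun c => c = w ∨ (c ≠ v ∧ f c = some j)) =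
        weightOf x (fun c => c = w) + weightOf x (fun c => c ≠ v ∧ f c = some j) :=
      weightOf_eq_add (by grind) (by grind)
    have h3 : weightOf x (fun c => c ≠ v ∧ (f c = none ∨ f c = some i ∨ f c = some j)) =
        weightOf x (fun c => (cutGraph f' v N).Adj w c) +
          weightOf x (fun c => c ≠ v ∧ f c = some i) :=
      weightOf_eq_add (by simp only [cutGraph_adj]; grind) (by simp only [cutGraph_adj]; grind)
    rw [weightOf_eq] at h2
    unfold nbrSum partWeight
    linarith
  have hdiff := adjForm_sub_adjForm (G := cutGraph f v N) (H := cutGraph f' v N) (Z := {w}) x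
    (by simp) (by simp only [cutGraph_adj]; grind)
  rw [Finset.sum_singleton] at hdiff
  by_contra! hlt
  refine absurd (hmax _ _ _ hdata) (not_le.2 (spectralRadius_lt_of_adjForm_lt he ?_))
  have := hx w
  nlinarith

set_option maxHeartbeats 1000000 in
lemma IsMaxCutData.card_part_eq (hM : IsMaxCutData h κ δ f v N) (hx : ∀ a, 0 < x a)
    (he : ∀ a, nbrSum (cutGraph f v N) x a = (cutGraph f v N).spectralRadius * x a)
    (hr : 2 ≤ r) (hκδ : κ + 1 ≤ δ) (hδ : δ < κ + h) {i : Fin r} (hi : f v = some i) :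
    (Finset.univ.filter (f · = some i)).card = h + 1 := by
  by_contra hcard
  have hi2 : h + 2 ≤ (Finset.univ.filter (f · = some i)).card := by
    have := hM.1.card_part i
    omega
  have : Nontrivial (Fin r) := Fin.nontrivial_iff_two_le.2 hr
  obtain ⟨j, hji⟩ := exists_ne i
  have hlt := hM.partWeight_lt hx he hr hκδ hδ hji.symm hi2
  have hj : (Finset.univ.filter (f · = some j)).card = h + 1 := by
    by_contra hj
    have h1 := hM.1.card_part j
    exact lt_asymm hlt (hM.partWeight_lt hx he hr hκδ hδ hji (by omega))
  have hTc := hM.card_filter_ne_none_add hx he hr hκδ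
  have hSN := hM.mem_of_eq_none hx he hr hκδ
  obtain ⟨hD, hmax⟩ := hM
  have hmem := hD.mem
  have hx' : ∀ a, 0 ≤ x a := fun a => (hx a).le
  set T := N.filter (f · ≠ none) with hT
  set P := (Finset.univ.filter (f · = some i)).erase v with hP
  set Q := Finset.univ.filter (f · = some j) with hQ
  have hmT : ∀ b, b ∈ T ↔ b ∈ N ∧ f b ≠ none := by simp [hT]
  have hmP : ∀ b, b ∈ P ↔ b ≠ v ∧ f b = some i := by simp [hP]
  have hmQ : ∀ b, b ∈ Q ↔ f b = some j := by simp [hQ]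
  have hPcard : h + 1 ≤ P.card := by
    rw [hP, Finset.card_erase_of_mem (by simpa using hi)]
    omega
  have hTP : T ⊆ P := by grind
  have hPw : partWeight f v x i = ∑ b ∈ P, x b := by
    rw [← weightOf_mem_finset]
    exact weightOf_congr fun b => (hmP b).symm
  have hQw : partWeight f v x j = ∑ b ∈ Q, x b := by
    rw [← weightOf_mem_finset]
    exact weightOf_congr fun b => by grind
  rw [hPw, hQw] at hlt
  set ρ := (cutGraph f v N).spectralRadius with hρ
  set s := weightOf x (fun b => f b = none) with hs
  have hρ0 : 0 ≤ ρ := spectralRadius_nonneg_of_pos hx he v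
  obtain ⟨w, hw⟩ : Q.Nonempty := Finset.card_pos.1 (by omega)
  have hwv : w ≠ v := by grind
  have hvw := hwv.symm
  have hxQ : ∀ q ∈ Q, (ρ + 1) * x q = s + ∑ b ∈ Q, x b := by
    intro q hq
    have h1 : weightOf x (fun b => f b = none ∨ b ∈ Q) = s + weightOf x (· ∈ Q) :=
      weightOf_eq_add (by grind) (by grind)
    have h2 : weightOf x (fun b => f b = none ∨ b ∈ Q) =
        weightOf x ((cutGraph f v N).Adj q) + weightOf x (· = q) :=
      weightOf_eq_add (by simp only [cutGraph_adj]; grind) (by simp only [cutGraph_adj]; grind)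
    rw [weightOf_mem_finset] at h1
    rw [weightOf_eq] at h2
    have h3 := he q
    rw [nbrSum] at h3
    linarith
  have hxP : ∀ p ∈ P, s + ∑ b ∈ P, x b ≤ (ρ + 1) * x p := by
    intro p hp
    have h1 : weightOf x (fun b => f b = none ∨ b ∈ P) = s + weightOf x (· ∈ P) :=
      weightOf_eq_add (by grind) (by grind)
    have h2 : weightOf x (fun b => f b = none ∨ b ∈ P) ≤
        weightOf x ((cutGraph f v N).Adj p) + weightOf x (· = p) :=
      weightOf_le_add hx' (by simp only [cutGraph_adj]; grind)
    rw [weightOf_mem_finset] at h1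
    rw [weightOf_eq] at h2
    have h3 := he p
    rw [nbrSum] at h3
    linarith
  have hQeq : ∀ q ∈ Q, x q = x w := fun q hq =>
    mul_left_cancel₀ (by positivity : ρ + 1 ≠ 0) ((hxQ q hq).trans (hxQ w hw).symm)
  have hPge : ∀ p ∈ P, x w ≤ x p := by
    intro p hp
    refine le_of_mul_le_mul_left ?_ (by positivity : 0 < ρ + 1)
    linarith [hxQ w hw, hxP p hp]
  obtain ⟨T', hT'Q, hT'⟩ := Finset.exists_subset_card_eq (s := Q.erase w) (n := T.card)
    (by rw [Finset.card_erase_of_mem hw]; omega)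
  have hwQ := Finset.card_erase_of_mem hw
  set L := Q.erase w \ T' with hL
  set R := P \ T with hR
  have hLc : L.card = h - T.card := by
    rw [hL, Finset.card_sdiff_of_subset hT'Q]
    omega
  have hRc : h + 1 - T.card ≤ R.card := by
    rw [hR, Finset.card_sdiff_of_subset hTP]
    omega
  have hPs : ∑ b ∈ R, x b + ∑ b ∈ T, x b = ∑ b ∈ P, x b := Finset.sum_sdiff hTP
  have hQs : ∑ b ∈ L, x b + ∑ b ∈ T', x b = ∑ b ∈ Q.erase w, x b := Finset.sum_sdiff hT'Q
  have hQs' : ∑ b ∈ Q.erase w, x b + x w = ∑ b ∈ Q, x b := Finset.sum_erase_add _ _ hw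
  have hLR : ∑ b ∈ L, x b < ∑ b ∈ R, x b := by
    have h1 : ∑ b ∈ L, x b = L.card • x w := by
      rw [← Finset.sum_const]
      exact Finset.sum_congr rfl fun b hb => hQeq b (by grind)
    have h2 := Finset.card_nsmul_le_sum R x (x w) fun b hb => hPge b (by grind)
    have h3 : (L.card : ℝ) + 1 ≤ R.card := by
      have : L.card + 1 ≤ R.card := by omega
      exact_mod_cast this
    rw [h1]
    rw [nsmul_eq_mul] at h2 ⊢
    have := hx w
    nlinarith
  have hL0 : 0 ≤ ∑ b ∈ L, x b := Finset.sum_nonneg fun b _ => hx' b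
  set S := Finset.univ.filter (f · = none) with hS
  have hmS : ∀ b, b ∈ S ↔ f b = none := by simp [hS]
  have hN'c : (S ∪ T').card = δ := by
    rw [Finset.card_union_of_disjoint, hD.card_cut, hT']
    · omega
    · rw [Finset.disjoint_left]
      grind
  have hnv : weightOf x ((cutGraph f v N).Adj v) = s + ∑ b ∈ T, x b := by
    rw [← weightOf_mem_finset]
    exact weightOf_eq_add (by simp only [cutGraph_adj]; grind) (by grind)
  have hnw : weightOf x ((cutGraph f v N).Adj w) = s + ∑ b ∈ Q.erase w, x b := by
    rw [← weightOf_mem_finset]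
    exact weightOf_eq_add (by simp only [cutGraph_adj]; grind) (by grind)
  rcases le_or_gt (x w) (x v) with hxvw | hxvw
  · have hdata : IsCutData h κ δ f w (S ∪ T') :=
      ⟨by grind, by grind, hN'c, hD.card_cut, hD.card_part⟩
    have hnv' : weightOf x ((cutGraph f w (S ∪ T')).Adj v) = s + ∑ b ∈ P, x b := by
      rw [← weightOf_mem_finset]
      exact weightOf_eq_add (by simp only [cutGraph_adj]; grind) (by grind)
    have hnw' : weightOf x ((cutGraph f w (S ∪ T')).Adj w) = s + ∑ b ∈ T', x b := by
      rw [← weightOf_mem_finset]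
      exact weightOf_eq_add (by simp only [cutGraph_adj]; grind) (by grind)
    have hdiff := adjForm_sub_adjForm (G := cutGraph f v N) (H := cutGraph f w (S ∪ T'))
      (Z := {v, w}) x (by simp only [cutGraph_adj]; grind) (by simp only [cutGraph_adj]; grind)
    rw [Finset.sum_pair hvw, nbrSum, nbrSum, nbrSum, nbrSum, hnv, hnw, hnv', hnw'] at hdiff
    refine absurd (hmax _ _ _ hdata) (not_le.2 (spectralRadius_lt_of_adjForm_lt he ?_))
    have := hx w
    nlinarith
  · set f' : V → Option (Fin r) := fun a => f (Equiv.swap v w a) with hf'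
    have hf1 : f' v = some j := by simp only [hf', Equiv.swap_apply_left]; grind
    have hf2 : f' w = some i := by simp [hf', hi]
    have hf3 : ∀ a, a ≠ v → a ≠ w → f' a = f a := fun a h1 h2 => by
      simp [hf', Equiv.swap_apply_of_ne_of_ne h1 h2]
    have hdata : IsCutData h κ δ f' v (S ∪ T') := by
      refine ⟨by simp [hf1], ?_, hN'c, ?_, ?_⟩
      · intro c hc
        have := hf3 c
        grind
      · rw [card_filter_comp_swap, hD.card_cut]
      · exact fun j => by rw [card_filter_comp_swap]; exact hD.card_part j
    have hnv' : weightOf x ((cutGraph f' v (S ∪ T')).Adj v) = s + ∑ b ∈ T', x b := by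
      rw [← weightOf_mem_finset]
      exact weightOf_eq_add (by simp only [cutGraph_adj]; grind) (by grind)
    have hnw' : weightOf x ((cutGraph f' v (S ∪ T')).Adj w) = s + ∑ b ∈ P, x b := by
      rw [← weightOf_mem_finset]
      refine weightOf_eq_add (fun b => ?_) (by grind)
      have := hf3 b
      simp only [cutGraph_adj]
      grind
    have hdiff := adjForm_sub_adjForm (G := cutGraph f v N) (H := cutGraph f' v (S ∪ T'))
      (Z := {v, w}) x (by simp only [cutGraph_adj]; grind) (by simp only [cutGraph_adj]; grind)
    rw [Finset.sum_pair hvw, nbrSum, nbrSum, nbrSum, nbrSum, hnv, hnw, hnv', hnw'] at hdiff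
    refine absurd (hmax _ _ _ hdata) (not_le.2 (spectralRadius_lt_of_adjForm_lt he ?_))
    have := hx v
    nlinarith

end Maximal

end CutGraph

section Extremal

variable {V : Type*} {r : ℕ}

/-- The data of an extremal graph: the neighbourhood of `v` consists of the cut and of vertices
of the part of `v`, which has index `i`, and the parts have the sizes prescribed by `p`. -/
structure IsExtremalData [Fintype V] (κ δ : ℕ) (p : Fin r → ℕ) (i : Fin r)
    (f : V → Option (Fin r)) (v : V) (N : Finset V) : Prop where
  apply_eq : f v = some i
  mem : ∀ b ∈ N, b ≠ v ∧ (f b = none ∨ f b = some i)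
  mem_of_eq_none : ∀ b, f b = none → b ∈ N
  card_nbrs : N.card = δ
  card_cut : (Finset.univ.filter (f · = none)).card = κ
  card_part : ∀ j, (Finset.univ.filter (f · = some j)).card = p j

/-- The refinement of the partition `f` in which `v` and its neighbours outside the cut form
classes of their own. -/
def cutColor [DecidableEq V] (f : V → Option (Fin r)) (v : V) (N : Finset V) (a : V) :
    Option (Fin r) ⊕ Bool :=
  if a = v then .inr false else if a ∈ N ∧ f a ≠ none then .inr true else .inl (f a)

/-- The sizes of the classes of `cutColor` for extremal data. -/
def cutColorCount (κ δ : ℕ) (p : Fin r → ℕ) (i : Fin r) : Option (Fin r) ⊕ Bool → ℕ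
  | .inr false => 1
  | .inr true => δ - κ
  | .inl none => κ
  | .inl (some j) => if j = i then p i - (δ - κ + 1) else p j

lemma IsExtremalData.card_cutColor [Fintype V] [DecidableEq V] {κ δ : ℕ} {p : Fin r → ℕ}
    {i : Fin r} {f : V → Option (Fin r)} {v : V} {N : Finset V}
    (hE : IsExtremalData κ δ p i f v N) (c : Option (Fin r) ⊕ Bool) :
    (Finset.univ.filter (cutColor f v N · = c)).card = cutColorCount κ δ p i c := by
  obtain ⟨hv, hmem, hSN, hN, hS, hC⟩ := hE
  have hT : (N.filter (f · ≠ none)).card = δ - κ := by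
    have h1 : N.filter (f · = none) = Finset.univ.filter (f · = none) := by
      ext a
      have := hSN a
      simp
      grind
    have h2 := Finset.card_filter_add_card_filter_not (s := N) (f · = none)
    rw [h1, hS, hN] at h2
    simp only [ne_eq]
    omega
  rcases c with (_ | j) | (_ | _)
  · rw [cutColorCount, ← hS]
    congr 1
    ext a
    have := hmem a
    simp only [cutColor, Finset.mem_filter, Finset.mem_univ, true_and]
    grind
  · rw [cutColorCount]
    split_ifs with hj
    · subst hj
      have h1 : Finset.univ.filter (cutColor f v N · = .inl (some j)) =
          Finset.univ.filter (f · = some j) \ insert v (N.filter (f · ≠ none)) := by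
        ext a
        simp only [cutColor, Finset.mem_filter, Finset.mem_univ, true_and, Finset.mem_sdiff,
          Finset.mem_insert]
        grind
      rw [h1, Finset.card_sdiff_of_subset, hC, Finset.card_insert_of_notMem, hT]
      · intro hvT
        exact (hmem v (Finset.mem_filter.1 hvT).1).1 rfl
      · intro a
        have := hmem a
        simp only [Finset.mem_filter, Finset.mem_univ, true_and, Finset.mem_insert]
        grind
    · rw [← hC]
      congr 1
      ext a
      have := hmem a
      simp only [cutColor, Finset.mem_filter, Finset.mem_univ, true_and]
      grind
  · rw [cutColorCount, Finset.card_eq_one]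
    refine ⟨v, ?_⟩
    ext a
    simp only [cutColor, Finset.mem_singleton]
    grind
  · rw [cutColorCount, ← hT]
    congr 1
    ext a
    have := hmem a
    simp only [cutColor]
    grind

lemma IsExtremalData.nonempty_iso {W : Type*} [Fintype V] [Fintype W] {κ δ : ℕ} {p : Fin r → ℕ}
    {i : Fin r} {f : V → Option (Fin r)} {v : V} {N : Finset V}
    {f' : W → Option (Fin r)} {v' : W} {N' : Finset W}
    (hE : IsExtremalData κ δ p i f v N) (hE' : IsExtremalData κ δ p i f' v' N') :
    Nonempty (cutGraph f v N ≃g cutGraph f' v' N') := by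
  classical
  have hfib : ∀ c, Nonempty ({a // cutColor f v N a = c} ≃ {b // cutColor f' v' N' b = c}) := by
    intro c
    refine ⟨Fintype.equivOfCardEq ?_⟩
    rw [Fintype.card_subtype, Fintype.card_subtype, hE.card_cutColor, hE'.card_cutColor]
  let e : V ≃ W := Equiv.ofFiberEquiv fun c => (hfib c).some
  have he : ∀ a, cutColor f' v' N' (e a) = cutColor f v N a := fun a =>
    Equiv.ofFiberEquiv_map (fun c => (hfib c).some) a
  obtain ⟨hv, hmem, hSN, -, -, -⟩ := hE
  obtain ⟨hv', hmem', hSN', -, -, -⟩ := hE'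
  have hev : ∀ a, e a = v' ↔ a = v := by
    intro a
    have := he a
    simp only [cutColor] at this
    grind
  have hef : ∀ a, f' (e a) = f a := by
    intro a
    have h1 := he a
    have h2 := hmem a
    have h3 := hmem' (e a)
    simp only [cutColor] at h1
    grind
  have heN : ∀ a, e a ∈ N' ↔ a ∈ N := by
    intro a
    have h1 := he a
    have h2 := hef a
    have h3 := hev a
    have h4 := hmem a
    have h5 := hmem' (e a)
    have h6 := hSN a
    have h7 := hSN' (e a)
    simp only [cutColor] at h1
    grind
  refine ⟨⟨e, ?_⟩⟩
  intro a b
  simp only [cutGraph_adj, hev, hef, heN, ne_eq, e.injective.eq_iff]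

lemma exists_gStarMid_data {n h κ δ : ℕ} (hκδ : κ + 1 ≤ δ) (hδ : δ < κ + h) {i j : Fin r}
    (hij : i ≠ j) :
    ∃ (f : GVert n r h κ → Option (Fin r)) (v : GVert n r h κ) (N : Finset (GVert n r h κ)),
      IsExtremalData κ δ
        (fun k => if k = j then n - κ - (r - 1) * (h + 1) else h + 1) i f v N ∧
      cutGraph f v N = GStarMid n r h κ δ := by
  classical
  obtain ⟨σ⟩ : Nonempty (Fin (r - 2) ≃ {k : Fin r // k ≠ i ∧ k ≠ j}) := by
    refine ⟨Fintype.equivOfCardEq ?_⟩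
    have h1 : Finset.univ.filter (fun k : Fin r => k ≠ i ∧ k ≠ j) = {i, j}ᶜ := by
      ext k
      simp
    rw [Fintype.card_subtype, h1, Finset.card_compl, Finset.card_pair hij]
    simp
  have hσi : ∀ k, (σ k : Fin r) ≠ i := fun k => (σ k).2.1
  have hσj : ∀ k, (σ k : Fin r) ≠ j := fun k => (σ k).2.2
  let f : GVert n r h κ → Option (Fin r)
    | .inl _ => none
    | .inr (.inl _) => some j
    | .inr (.inr (.inl q)) => some (σ q.1)
    | .inr (.inr (.inr _)) => some i
  let v : GVert n r h κ := .inr (.inr (.inr (.inr ())))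
  let N : Finset (GVert n r h κ) := Finset.univ.filter ((GStarMid n r h κ δ).Adj v)
  have hvS : ∀ a, (GStarMid n r h κ δ).Adj v (.inl a) := by simp [v, GStarMid]
  have hvj : ∀ a, ¬ (GStarMid n r h κ δ).Adj v (.inr (.inl a)) := by simp [v, GStarMid]
  have hvσ : ∀ a, ¬ (GStarMid n r h κ δ).Adj v (.inr (.inr (.inl a))) := by simp [v, GStarMid]
  have hvi : ∀ a, (GStarMid n r h κ δ).Adj v (.inr (.inr (.inr (.inl a)))) ↔
      (a : ℕ) < δ - κ := by simp [v, GStarMid]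
  have hvv : ∀ a, ¬ (GStarMid n r h κ δ).Adj v (.inr (.inr (.inr (.inr a)))) := by
    simp [v, GStarMid]
  have hcardN : N.card = δ := by
    have hf : (Finset.univ.filter fun k : Fin h => (k : ℕ) < δ - κ).card = δ - κ := by
      rw [Fin.card_filter_val_lt]
      omega
    have : N.card = κ + (Finset.univ.filter fun k : Fin h => (k : ℕ) < δ - κ).card := by
      simp only [N, Finset.card_filter, Fintype.sum_sum_type, hvS, hvj, hvσ, hvi, hvv]
      simp
    omega
  have hN : ∀ b, b ∈ N ↔ (GStarMid n r h κ δ).Adj v b := fun b => by simp [N]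
  clear_value N
  refine ⟨f, v, N, ⟨rfl, ?_, ?_, hcardN, ?_, ?_⟩, ?_⟩
  · rintro (b | b | b | b | b) <;> simp [hN, hvj, hvσ, v, f]
  · rintro (b | b | b | b | b) <;> simp [hN, hvS, f]
  · simp only [Finset.card_filter, Fintype.sum_sum_type, f]
    simp
  · intro k
    simp only [Finset.card_filter, Fintype.sum_sum_type, Fintype.sum_prod_type, f]
    by_cases hkj : k = j
    · subst hkj
      simp [hσj, hij]
    · by_cases hki : k = i
      · subst hki
        simp [hσi, hij, hij.symm]
      · have h1 : ∀ y, ((σ y : Fin r) = k) ↔ y = σ.symm ⟨k, hki, hkj⟩ := by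
          intro y
          rw [Equiv.eq_symm_apply, Subtype.ext_iff]
        simp [h1, hkj, Ne.symm hkj, Ne.symm hki]
  · ext a b
    rw [cutGraph_adj]
    rcases a with a | a | a | a | a <;> rcases b with b | b | b | b | b <;>
      simp [hN, v, f, GStarMid, hσi, hσj, hij, hij.symm, Ne.symm (hσi _), Ne.symm (hσj _)]
    rw [← Subtype.ext_iff, σ.injective.eq_iff, eq_comm (a := b.1), or_self]
    exact fun _ => Iff.rfl

end Extremal

lemma IsCutData.exists_isMaxCutData {V : Type*} [Fintype V] {r h κ δ : ℕ}
    {f : V → Option (Fin r)} {v : V} {N : Finset V} (hD : IsCutData h κ δ f v N) :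
    ∃ (f' : V → Option (Fin r)) (v' : V) (N' : Finset V), IsMaxCutData h κ δ f' v' N' := by
  let D := {d : (V → Option (Fin r)) × V × Finset V // IsCutData h κ δ d.1 d.2.1 d.2.2}
  have : Nonempty D := ⟨⟨(f, v, N), hD⟩⟩
  have : Finite D := Subtype.finite
  obtain ⟨d, hd⟩ := Finite.exists_max fun d : D =>
    (cutGraph d.1.1 d.1.2.1 d.1.2.2).spectralRadius
  exact ⟨_, _, _, d.2, fun f' v' N' hD' => hd ⟨(f', v', N'), hD'⟩⟩

/-- Apart from at most one part, which is not the part of `v`, all parts of data of maximal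
spectral radius have the least possible size. -/
lemma IsMaxCutData.exists_card_part_eq {V : Type*} [Fintype V] [DecidableEq V] {r h κ δ : ℕ}
    {f : V → Option (Fin r)} {v : V} {N : Finset V} (hM : IsMaxCutData h κ δ f v N)
    (hr : 2 ≤ r) (hκ : 1 ≤ κ) (hκδ : κ + 1 ≤ δ) (hδ : δ < κ + h) {i : Fin r}
    (hi : f v = some i) :
    (∀ w, f w = none → w ∈ N) ∧ ∃ j, i ≠ j ∧
      ∀ k, k ≠ j → (Finset.univ.filter (f · = some k)).card = h + 1 := by
  obtain ⟨x, hx, he⟩ := exists_pos_eigenvector (hM.1.connected hκ (by omega))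
  refine ⟨hM.mem_of_eq_none hx he hr hκδ, ?_⟩
  have hcard := hM.card_part_eq hx he hr hκδ hδ hi
  by_cases hbig : ∃ j, h + 2 ≤ (Finset.univ.filter (f · = some j)).card
  · obtain ⟨j, hj⟩ := hbig
    refine ⟨j, by rintro rfl; omega, fun k hkj => ?_⟩
    by_contra hk
    have hk2 : h + 2 ≤ (Finset.univ.filter (f · = some k)).card := by
      have := hM.1.card_part k
      omega
    exact lt_asymm (hM.partWeight_lt hx he hr hκδ hδ hkj hk2)
      (hM.partWeight_lt hx he hr hκδ hδ hkj.symm hj)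
  · push Not at hbig
    have : Nontrivial (Fin r) := Fin.nontrivial_iff_two_le.2 hr
    obtain ⟨j, hj⟩ := exists_ne i
    refine ⟨j, hj.symm, fun k _ => ?_⟩
    have h1 := hM.1.card_part k
    have h2 := hbig k
    omega

lemma card_part_add_of_card_part_eq {V : Type*} [Fintype V] {r h : ℕ}
    {f : V → Option (Fin r)} {j : Fin r}
    (hj : ∀ k, k ≠ j → (Finset.univ.filter (f · = some k)).card = h + 1) :
    (Finset.univ.filter (f · = none)).card + (r - 1) * (h + 1) +
      (Finset.univ.filter (f · = some j)).card = Fintype.card V := by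
  classical
  have h1 := Finset.card_eq_sum_card_fiberwise (f := f) (s := Finset.univ) (t := Finset.univ)
    (fun _ _ => Finset.mem_univ _)
  rw [Fintype.sum_option, ← Finset.add_sum_erase _ _ (Finset.mem_univ j),
    Finset.sum_congr rfl fun k hk => hj k (Finset.ne_of_mem_erase hk), Finset.sum_const,
    Finset.card_erase_of_mem (Finset.mem_univ j), smul_eq_mul] at h1
  simp only [Finset.card_univ, Fintype.card_fin] at h1
  omega

lemma IsMaxCutData.nonempty_iso_gStarMid {V : Type*} [Fintype V] [DecidableEq V] {r h κ δ : ℕ}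
    {f : V → Option (Fin r)} {v : V} {N : Finset V} (hM : IsMaxCutData h κ δ f v N)
    (hr : 2 ≤ r) (hκ : 1 ≤ κ) (hκδ : κ + 1 ≤ δ) (hδ : δ < κ + h) :
    Nonempty (cutGraph f v N ≃g GStarMid (Fintype.card V) r h κ δ) := by
  obtain ⟨i, hi⟩ := Option.ne_none_iff_exists'.1 hM.1.ne_none
  obtain ⟨hSN, j, hij, hj⟩ := hM.exists_card_part_eq hr hκ hκδ hδ hi
  have hsum := card_part_add_of_card_part_eq hj
  obtain ⟨f', v', N', hE', hG⟩ := exists_gStarMid_data (n := Fintype.card V) hκδ hδ hij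
  rw [← hG]
  refine IsExtremalData.nonempty_iso ⟨hi, fun b hb => hi ▸ hM.1.mem b hb, hSN, hM.1.card_nbrs,
    hM.1.card_cut, fun k => ?_⟩ hE'
  have := hM.1.card_cut
  split_ifs with hkj
  · subst hkj
    omega
  · exact hj k hkj

/-- A good vertex cut partitions the remaining vertices into `r` large parts without edges between
them. -/
lemma GoodVertexCut.exists_parts {V : Type*} [Fintype V] {G : SimpleGraph V} {r h : ℕ}
    {S : Finset V} (hS : GoodVertexCut G r h S) (hr : 1 ≤ r) :
    ∃ f : V → Option (Fin r), (∀ a, f a = none ↔ a ∈ S) ∧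
      (∀ a b, G.Adj a b → f a = none ∨ f b = none ∨ f a = f b) ∧
      ∀ i, h + 1 ≤ (Finset.univ.filter (f · = some i)).card := by
  classical
  obtain ⟨hcomp, hsupp⟩ := hS
  have : Nonempty (Fin r) := ⟨⟨0, hr⟩⟩
  obtain ⟨g, hg⟩ : ∃ g : (G.induce ((S : Set V)ᶜ)).ConnectedComponent → Fin r,
      Function.Surjective g := by
    have e := Finite.equivFin (G.induce ((S : Set V)ᶜ)).ConnectedComponent
    have hinj : Function.Injective (e.symm ∘ Fin.castLE hcomp) :=
      e.symm.injective.comp (Fin.castLE_injective hcomp)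
    exact ⟨_, Function.invFun_surjective hinj⟩
  let f : V → Option (Fin r) := fun a =>
    if ha : a ∈ S then none else
      some (g ((G.induce ((S : Set V)ᶜ)).connectedComponentMk ⟨a, by simpa using ha⟩))
  refine ⟨f, fun a => by simp [f], fun a b hab => ?_, fun i => ?_⟩
  · by_cases ha : a ∈ S
    · simp [f, ha]
    by_cases hb : b ∈ S
    · simp [f, hb]
    right; right
    simp only [f, ha, hb, dif_neg, not_false_eq_true]
    congr 2
    exact SimpleGraph.ConnectedComponent.sound (SimpleGraph.Adj.reachable (by simpa using hab))
  · obtain ⟨c, hc⟩ := hg i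
    refine (hsupp c).trans ?_
    rw [Nat.card_eq_fintype_card, ← Fintype.card_coe]
    refine Fintype.card_le_of_injective
      (fun a => ⟨a.1.1, ?_⟩) fun a b hab => ?_
    · have ha : a.1.1 ∉ S := fun h => a.1.2 h
      simp only [f, ha, Finset.mem_filter_univ, dif_neg, not_false_eq_true]
      rw [← hc]
      congr 2
      exact a.2
    · simpa [Subtype.ext_iff] using hab

lemma spectralRadius_lt_of_lt {V : Type*} [Fintype V] {G H : SimpleGraph V} (hG : G.Connected)
    (hGH : G < H) : G.spectralRadius < H.spectralRadius := by
  obtain ⟨x, hx, he⟩ := exists_pos_eigenvector hG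
  have hx' : ∀ a, 0 ≤ x a := fun a => (hx a).le
  obtain ⟨a, b, hab, hnab⟩ : ∃ a b, H.Adj a b ∧ ¬ G.Adj a b := by
    by_contra! hle
    exact hGH.not_ge fun a b hab => hle a b hab
  refine spectralRadius_lt_of_adjForm_le hx he (adjForm_mono hGH.le hx') (a := a) (ne_of_lt ?_)
  have hb : weightOf x (H.Adj a) = weightOf x (G.Adj a) +
      weightOf x fun c => H.Adj a c ∧ ¬ G.Adj a c :=
    weightOf_eq_add
      (fun c => by have : G.Adj a c → H.Adj a c := fun h => hGH.le h; tauto) fun c => by tauto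
  have hpos := weightOf_pos hx (P := fun c => H.Adj a c ∧ ¬ G.Adj a c) ⟨hab, hnab⟩
  rw [nbrSum, nbrSum, hb]
  linarith

lemma spectralRadius_lt_or_nonempty_iso_gStarMid {V : Type*} [Fintype V] [DecidableEq V]
    {G : SimpleGraph V} {r h κ δ : ℕ} (hr : 2 ≤ r) (hκ : 1 ≤ κ) (hκδ : κ + 1 ≤ δ)
    (hδ : δ < κ + h) (hV : κ + r * (h + 1) ≤ Fintype.card V) (hconn : G.Connected)
    {f : V → Option (Fin r)} {v : V} {N : Finset V} (hvN : v ∉ N) (hN : N.card = δ)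
    (hS : (Finset.univ.filter (f · = none)).card = κ)
    (hC : ∀ i, h + 1 ≤ (Finset.univ.filter (f · = some i)).card)
    (hadj : ∀ a b, G.Adj a b → f a = none ∨ f b = none ∨ f a = f b)
    (hGN : ∀ b, G.Adj v b ↔ b ∈ N) :
    G.spectralRadius < (GStarMid (Fintype.card V) r h κ δ).spectralRadius ∨
      Nonempty (G ≃g GStarMid (Fintype.card V) r h κ δ) := by
  have hle : G ≤ cutGraph f v N := by
    intro a b hab
    have h1 := hGN a
    have h2 := hGN b
    have h3 := hadj a b hab
    have h4 := hab.symm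
    have h5 := hab.ne
    rw [cutGraph_adj]
    grind
  have hmax : ∀ {f' : V → Option (Fin r)} {v' : V} {N' : Finset V}, IsCutData h κ δ f' v' N' →
      (cutGraph f' v' N').spectralRadius ≤
        (GStarMid (Fintype.card V) r h κ δ).spectralRadius ∧
      (IsMaxCutData h κ δ f' v' N' ∨ (cutGraph f' v' N').spectralRadius <
        (GStarMid (Fintype.card V) r h κ δ).spectralRadius) := by
    intro f' v' N' hD
    obtain ⟨f₀, v₀, N₀, hM⟩ := hD.exists_isMaxCutData
    obtain ⟨e⟩ := hM.nonempty_iso_gStarMid hr hκ hκδ hδ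
    rw [← spectralRadius_eq_of_iso e]
    have h1 := hM.2 _ _ _ hD
    refine ⟨h1, ?_⟩
    rcases h1.lt_or_eq with h2 | h2
    · exact .inr h2
    · exact .inl ⟨hD, fun _ _ _ hD' => (hM.2 _ _ _ hD').trans h2.ge⟩
  by_cases hv : f v = none
  · left
    obtain ⟨x, hx, he⟩ := exists_pos_eigenvector hconn
    have hx' : ∀ a, 0 ≤ x a := fun a => (hx a).le
    obtain ⟨f', v', N', hD, hq, a, ha⟩ :=
      exists_isCutData_of_eq_none hx hr hκδ hδ hV hv hvN hN hS hC
    have h1 := (nbrSum_mono hle hx' a).trans_lt ha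
    exact (spectralRadius_lt_of_adjForm_le hx he ((adjForm_mono hle hx').trans hq)
      h1.ne).trans_le (hmax hD).1
  · have hD : IsCutData h κ δ f v N := by
      refine ⟨hv, fun b hb => ?_, hN, hS, hC⟩
      have h1 := (hGN b).2 hb
      have h2 := hadj v b h1
      have h3 := h1.ne
      grind
    rcases hle.lt_or_eq with hlt | heq
    · exact .inl ((spectralRadius_lt_of_lt hconn hlt).trans_le (hmax hD).1)
    · rw [heq]
      rcases (hmax hD).2 with hM | hlt
      · exact .inr (hM.nonempty_iso_gStarMid hr hκ hκδ hδ)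
      · exact .inl hlt

theorem spectral_extremal_extraConnectivity_mid {V : Type*} [Fintype V] [DecidableEq V]
    (G : SimpleGraph V) [DecidableRel G.Adj] (n r h κ δ : ℕ)
    (hr : 2 ≤ r) (hh : 1 ≤ h) (hκ : 1 ≤ κ) (hδ : 1 ≤ δ) (hn : 1 ≤ n)
    (hκδ : κ + 1 ≤ δ) (hδκh : δ < κ + h) (hnbig : κ + r * (h + 1) ≤ n)
    (hcard : Fintype.card V = n) (hconn : G.Connected)
    (hmin : G.minDegree = δ) (hκG : HasExtraConnectivity G r h κ) :
    G.spectralRadius ≤ (GStarMid n r h κ δ).spectralRadius ∧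
      (G.spectralRadius = (GStarMid n r h κ δ).spectralRadius ↔
        Nonempty (G ≃g GStarMid n r h κ δ)) := by
  subst hcard
  obtain ⟨⟨S, hS, hgood⟩, -⟩ := hκG
  obtain ⟨f, hfS, hadj, hC⟩ := hgood.exists_parts (by omega)
  have := hconn.nonempty
  obtain ⟨v, hv⟩ := G.exists_minimal_degree_vertex
  have key := spectralRadius_lt_or_nonempty_iso_gStarMid hr hκ hκδ hδκh hnbig hconn
    (f := f) (v := v) (N := G.neighborFinset v) (by simp)
    (by rw [G.card_neighborFinset_eq_degree, ← hv, hmin])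
    (by simp only [hfS, Finset.filter_univ_mem, hS]) hC hadj (by simp)
  have hiso : Nonempty (G ≃g GStarMid (Fintype.card V) r h κ δ) →
      G.spectralRadius = (GStarMid (Fintype.card V) r h κ δ).spectralRadius :=
    fun ⟨e⟩ => spectralRadius_eq_of_iso e
  refine ⟨?_, fun heq => ?_, hiso⟩
  · exact key.elim le_of_lt fun h => (hiso h).le
  · exact key.resolve_left heq.not_lt
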